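/- arXiv:2104.08501 — 4 statements merged into one kernel-verified Lean document; each statement's English description precedes it below -/
import Mathlib

section
/- Let n be a positive integer, let p be a real number with 1/n ≤ p ≤ 1, let X be a binomial random variable with parameters n and p, and let c be a real number with 0 < c ≤ 3. Then E[X^c] ≤ 5·n^c·p^c. -/
/-- The expectation of `f X` for `X ~ Bin(n, p)`. -/
noncomputable def binomialExpect (n : ℕ) (p : ℝ) (f : ℕ → ℝ) : ℝ :=
  ∑ k ∈ Finset.range (n + 1), (n.choose k : ℝ) * p ^ k * (1 - p) ^ (n - k) * f k

namespace binomialExpect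

theorem mono {n : ℕ} {p : ℝ} (hp0 : 0 ≤ p) (hp1 : p ≤ 1) {f g : ℕ → ℝ} (h : ∀ k, f k ≤ g k) :
    binomialExpect n p f ≤ binomialExpect n p g := by
  have : 0 ≤ 1 - p := by linarith
  exact Finset.sum_le_sum fun k _ ↦ mul_le_mul_of_nonneg_left (h k) (by positivity)

theorem add (n : ℕ) (p : ℝ) (f g : ℕ → ℝ) :
    binomialExpect n p (fun k ↦ f k + g k) = binomialExpect n p f + binomialExpect n p g := by
  simp only [binomialExpect, mul_add, Finset.sum_add_distrib]

theorem const_mul (n : ℕ) (p a : ℝ) (f : ℕ → ℝ) :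
    binomialExpect n p (fun k ↦ a * f k) = a * binomialExpect n p f := by
  simp only [binomialExpect, Finset.mul_sum]
  exact Finset.sum_congr rfl fun k _ ↦ by ring

theorem const (n : ℕ) (p a : ℝ) : binomialExpect n p (fun _ ↦ a) = a := by
  have h := add_pow p (1 - p) n
  rw [add_sub_cancel, one_pow] at h
  rw [binomialExpect, ← Finset.sum_mul]
  conv_rhs => rw [← one_mul a, h]
  exact congrArg (· * a) (Finset.sum_congr rfl fun k _ ↦ by ring)

/-- Size biasing: `E[X g(X)] = (n + 1) p E[g(Y + 1)]` for `X ~ Bin(n + 1, p)`, `Y ~ Bin(n, p)`. -/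
theorem succ_self_mul (n : ℕ) (p : ℝ) (g : ℕ → ℝ) :
    binomialExpect (n + 1) p (fun k ↦ k * g k) =
      (n + 1) * p * binomialExpect n p (fun k ↦ g (k + 1)) := by
  rw [binomialExpect, Finset.sum_range_succ', binomialExpect, Finset.mul_sum]
  simp only [Nat.cast_zero, zero_mul, mul_zero, add_zero]
  refine Finset.sum_congr rfl fun k _ ↦ ?_
  have h : ((n : ℝ) + 1) * n.choose k = (n + 1).choose (k + 1) * (k + 1) := by
    exact_mod_cast Nat.add_one_mul_choose_eq n k
  rw [Nat.add_sub_add_right]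
  push_cast
  linear_combination -(p ^ (k + 1) * (1 - p) ^ (n - k) * g (k + 1)) * h

theorem self (n : ℕ) (p : ℝ) : binomialExpect n p (fun k ↦ k) = n * p := by
  cases n with
  | zero => simp [binomialExpect]
  | succ n => simpa [const] using succ_self_mul n p fun _ ↦ 1

theorem sq (n : ℕ) (p : ℝ) :
    binomialExpect n p (fun k ↦ (k : ℝ) ^ 2) = n * p * ((n - 1) * p + 1) := by
  cases n with
  | zero => simp [binomialExpect]
  | succ n =>
    simpa [pow_two, add, self, const] using succ_self_mul n p fun k ↦ k

theorem cube (n : ℕ) (p : ℝ) :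
    binomialExpect n p (fun k ↦ (k : ℝ) ^ 3) =
      n * p * ((n - 1) * p * ((n - 2) * p + 3) + 1) := by
  cases n with
  | zero => simp [binomialExpect]
  | succ n =>
    have h := succ_self_mul n p fun k ↦ (k : ℝ) ^ 2
    have e : (fun k : ℕ ↦ (((k + 1 : ℕ) : ℝ)) ^ 2) = fun k : ℕ ↦ (k : ℝ) ^ 2 + (2 * k + 1) := by
      funext k; push_cast; ring
    rw [e, add, add, const_mul, sq, self, const] at h
    simp only [← pow_succ'] at h
    rw [h]
    push_cast
    ring

theorem cube_le {n : ℕ} {p : ℝ} (hp0 : 0 ≤ p) (h : 1 ≤ n * p) :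
    binomialExpect n p (fun k ↦ (k : ℝ) ^ 3) ≤ 5 * (n * p) ^ 3 := by
  rw [cube]
  have hn : (1 : ℝ) ≤ n := by
    rcases Nat.eq_zero_or_pos n with rfl | hn
    · norm_num at h
    · exact_mod_cast hn
  have h1 : ((n : ℝ) - 1) * p * ((n - 2) * p + 3) ≤ n * p * (n * p + 3) := by
    have : ((n : ℝ) - 1) * p * ((n - 2) * p + 3) ≤ (n - 1) * p * (n * p + 3) :=
      mul_le_mul_of_nonneg_left (by linarith) (mul_nonneg (by linarith) hp0)
    refine this.trans ?_
    gcongr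
    linarith
  calc _ ≤ n * p * (n * p * (n * p + 3) + 1) := by gcongr
    _ ≤ _ := by
      generalize (n : ℝ) * p = m at h
      have h' : 0 ≤ m - 1 := sub_nonneg.2 h
      nlinarith [pow_nonneg h' 2, pow_nonneg h' 3]

end binomialExpect

/-- Interpolation of `x ^ c` between the constant and the cubic power, at scale `m`. -/
theorem Real.rpow_le_interpolate_cube {x m c : ℝ} (hx : 0 ≤ x) (hm : 0 < m)
    (hc0 : 0 ≤ c) (hc3 : c ≤ 3) :
    x ^ c ≤ m ^ c * (1 - c / 3) + m ^ c * (c / 3) / m ^ 3 * x ^ 3 := by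
  have h := Real.geom_mean_le_arith_mean2_weighted (w₁ := c / 3) (w₂ := 1 - c / 3)
    (p₁ := (x / m) ^ 3) (p₂ := 1) (by positivity) (by linarith) (by positivity) zero_le_one
    (by ring)
  rw [Real.one_rpow, mul_one, mul_one, ← Real.rpow_natCast_mul (by positivity),
    show ((3 : ℕ) : ℝ) * (c / 3) = c by push_cast; ring, Real.div_rpow hx hm.le,
    div_le_iff₀ (by positivity)] at h
  refine h.trans_eq ?_
  field_simp
  ring

theorem binomial_rpow_moment_le (n : ℕ) (hn : 0 < n) (p : ℝ)
    (hpl : 1 / (n : ℝ) ≤ p) (hp1 : p ≤ 1) (c : ℝ) (hc0 : 0 < c) (hc3 : c ≤ 3) :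
    ∑ k ∈ Finset.range (n + 1),
        (n.choose k : ℝ) * p ^ k * (1 - p) ^ (n - k) * (k : ℝ) ^ c
      ≤ 5 * (n : ℝ) ^ c * p ^ c := by
  have hn' : (0 : ℝ) < n := by exact_mod_cast hn
  have hp0 : 0 < p := lt_of_lt_of_le (by positivity) hpl
  have hm : 1 ≤ n * p := by rwa [div_le_iff₀' hn'] at hpl
  rw [mul_assoc, ← Real.mul_rpow hn'.le hp0.le]
  have hcube := binomialExpect.cube_le hp0.le hm
  set m : ℝ := n * p
  have hm0 : 0 < m := by linarith
  have hmc : 0 < m ^ c := by positivity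
  calc binomialExpect n p (fun k ↦ (k : ℝ) ^ c)
      ≤ binomialExpect n p
          (fun k ↦ m ^ c * (1 - c / 3) + m ^ c * (c / 3) / m ^ 3 * (k : ℝ) ^ 3) :=
        binomialExpect.mono hp0.le hp1 fun k ↦
          Real.rpow_le_interpolate_cube k.cast_nonneg hm0 hc0.le hc3
    _ = m ^ c * (1 - c / 3) +
          m ^ c * (c / 3) / m ^ 3 * binomialExpect n p (fun k ↦ (k : ℝ) ^ 3) := by
        rw [binomialExpect.add, binomialExpect.const, binomialExpect.const_mul]
    _ ≤ m ^ c * (1 - c / 3) + m ^ c * (c / 3) / m ^ 3 * (5 * m ^ 3) := by gcongr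
    _ = m ^ c * (1 + 4 * (c / 3)) := by field_simp; ring
    _ ≤ 5 * m ^ c := by nlinarith
end

section
/- Let G be a finite simple graph with T triangles in which every vertex is contained in at most τ triangles, where τ ≥ 1 is a real number, and let 0 ≤ p ≤ 1. If each vertex of G is kept independently with probability p and T' denotes the number of triangles of G all of whose three vertices are kept, then Var(T') ≤ p³·T + 3·p⁴·τ·T. -/
open Finset

/-- Under the product Bernoulli(`p`) weight, all vertices of `S` are kept with probability
`p ^ #S`. -/
theorem sum_bernoulli_weight_mul_indicator {V : Type*} [Fintype V] [DecidableEq V]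
    (p : ℝ) (S : Finset V) :
    ∑ f : V → Bool, (∏ v : V, if f v then p else 1 - p) *
      (if ∀ v ∈ S, f v = true then (1 : ℝ) else 0) = p ^ S.card := by
  have hind (f : V → Bool) : (if ∀ v ∈ S, f v = true then (1 : ℝ) else 0) =
      ∏ v : V, if v ∈ S then (if f v then 1 else 0) else 1 := by
    rw [Finset.prod_ite_mem, Finset.univ_inter, Finset.prod_boole]
    congr
  simp_rw [hind, ← Finset.prod_mul_distrib]
  have h := Finset.prod_univ_sum (fun _ : V => (Finset.univ : Finset Bool))
    (fun v b => (if b then p else 1 - p) * (if v ∈ S then (if b then 1 else 0) else 1))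
  rw [Fintype.piFinset_univ] at h
  rw [← h]
  have hv (v : V) : ∑ b : Bool, (if b then p else 1 - p) *
      (if v ∈ S then (if b then (1 : ℝ) else 0) else 1) = if v ∈ S then p else 1 := by
    by_cases hvS : v ∈ S <;> simp [hvS]
  simp_rw [hv]
  rw [Finset.prod_ite_mem, Finset.univ_inter, Finset.prod_const]

/-- The first moment of the number of fully kept members of a family of sets. -/
theorem sum_bernoulli_weight_mul_card {V : Type*} [Fintype V] [DecidableEq V]
    (p : ℝ) (K : Finset (Finset V)) :
    ∑ f : V → Bool, (∏ v : V, if f v then p else 1 - p) *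
      ((K.filter (fun s => ∀ v ∈ s, f v = true)).card : ℝ) = ∑ s ∈ K, p ^ s.card := by
  simp_rw [Finset.card_filter, Nat.cast_sum, Nat.cast_ite, Nat.cast_one, Nat.cast_zero,
    Finset.mul_sum]
  rw [Finset.sum_comm]
  exact Finset.sum_congr rfl fun s _ => sum_bernoulli_weight_mul_indicator p s

/-- The second moment of the number of fully kept members of a family of sets. -/
theorem sum_bernoulli_weight_mul_card_sq {V : Type*} [Fintype V] [DecidableEq V]
    (p : ℝ) (K : Finset (Finset V)) :
    ∑ f : V → Bool, (∏ v : V, if f v then p else 1 - p) *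
      ((K.filter (fun s => ∀ v ∈ s, f v = true)).card : ℝ) ^ 2 =
      ∑ s ∈ K, ∑ t ∈ K, p ^ (s ∪ t).card := by
  have hsq (f : V → Bool) : ((K.filter (fun s => ∀ v ∈ s, f v = true)).card : ℝ) ^ 2 =
      ∑ s ∈ K, ∑ t ∈ K, if ∀ v ∈ s ∪ t, f v = true then (1 : ℝ) else 0 := by
    rw [Finset.card_filter, Nat.cast_sum, sq, Finset.sum_mul_sum]
    refine Finset.sum_congr rfl fun s _ => Finset.sum_congr rfl fun t _ => ?_
    simp only [Finset.mem_union, or_imp, forall_and, ite_and]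
    push_cast
    rw [ite_mul, one_mul, zero_mul]
  simp_rw [hsq, Finset.mul_sum]
  rw [Finset.sum_comm]
  refine Finset.sum_congr rfl fun s _ => ?_
  rw [Finset.sum_comm]
  exact Finset.sum_congr rfl fun t _ => sum_bernoulli_weight_mul_indicator p (s ∪ t)

/-- The covariance of the indicators of two `3`-sets being kept is at most `p ^ 3` on the diagonal
and `p ^ 4` times the size of the intersection off it. -/
theorem pow_card_union_sub_le {V : Type*} [DecidableEq V] {p : ℝ} (hp0 : 0 ≤ p) (hp1 : p ≤ 1)
    {s t : Finset V} (hs : s.card = 3) (ht : t.card = 3) :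
    p ^ (s ∪ t).card - p ^ 3 * p ^ 3 ≤
      (if s = t then p ^ 3 else 0) + p ^ 4 * ((s ∩ t).card : ℝ) := by
  have h3 : 0 ≤ p ^ 3 := pow_nonneg hp0 3
  have h4 : 0 ≤ p ^ 4 := pow_nonneg hp0 4
  have hcard := Finset.card_union_add_card_inter s t
  split_ifs with hst
  · subst hst
    rw [Finset.union_self, Finset.inter_self, hs]
    push_cast
    nlinarith
  · rcases Nat.eq_zero_or_pos (s ∩ t).card with h0 | hpos
    · have h6 : (s ∪ t).card = 6 := by omega
      rw [h0, h6]
      apply le_of_eq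
      push_cast
      ring
    · have hge : 4 ≤ (s ∪ t).card := by
        by_contra hlt
        have hsu : s = s ∪ t := Finset.eq_of_subset_of_card_le Finset.subset_union_left (by omega)
        have htu : t = s ∪ t := Finset.eq_of_subset_of_card_le Finset.subset_union_right (by omega)
        exact hst (hsu.trans htu.symm)
      have hle : p ^ (s ∪ t).card ≤ p ^ 4 := pow_le_pow_of_le_one hp0 hp1 hge
      have hone : (1 : ℝ) ≤ ((s ∩ t).card : ℝ) := by exact_mod_cast hpos
      nlinarith

/-- Double counting: the intersections of `s` with the members of `K` have total size
the sum over the vertices of `s` of their degrees in `K`. -/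
theorem sum_card_inter_eq_sum_card_filter {V : Type*} [DecidableEq V]
    (K : Finset (Finset V)) (s : Finset V) :
    ∑ t ∈ K, (s ∩ t).card = ∑ v ∈ s, (K.filter (fun t => v ∈ t)).card := by
  simp_rw [← Finset.filter_mem_eq_inter, Finset.card_filter]
  exact Finset.sum_comm

/-- Let `G` be a finite simple graph with `T` triangles in which every
vertex lies in at most `τ` triangles (`τ ≥ 1` real), and keep each vertex independently
with probability `p`. If `T'` counts the fully-kept triangles, then
`Var(T') = E[T'²] − E[T']² ≤ p³·T + 3·p⁴·τ·T`. -/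
theorem variance_sampled_triangles_le
    {V : Type*} [Fintype V] [DecidableEq V]
    (G : SimpleGraph V) [DecidableRel G.Adj] (τ : ℝ) (hτ : 1 ≤ τ)
    (hlight : ∀ v : V, (((G.cliqueFinset 3).filter (fun t => v ∈ t)).card : ℝ) ≤ τ)
    (p : ℝ) (hp0 : 0 ≤ p) (hp1 : p ≤ 1) :
    (∑ f : V → Bool, (∏ v : V, if f v then p else 1 - p) *
        (((G.cliqueFinset 3).filter (fun Δ => ∀ v ∈ Δ, f v = true)).card : ℝ) ^ 2)
      - (∑ f : V → Bool, (∏ v : V, if f v then p else 1 - p) *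
          (((G.cliqueFinset 3).filter (fun Δ => ∀ v ∈ Δ, f v = true)).card : ℝ)) ^ 2
      ≤ p ^ 3 * ((G.cliqueFinset 3).card : ℝ)
        + 3 * p ^ 4 * τ * ((G.cliqueFinset 3).card : ℝ) := by
  rw [sum_bernoulli_weight_mul_card_sq, sum_bernoulli_weight_mul_card]
  set K := G.cliqueFinset 3
  have hcard : ∀ s ∈ K, s.card = 3 := fun s hs => (G.mem_cliqueFinset_iff.mp hs).card_eq
  have hrow : ∀ s ∈ K, ∑ t ∈ K, (p ^ (s ∪ t).card - p ^ 3 * p ^ 3) ≤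
      p ^ 3 + p ^ 4 * (3 * τ) := fun s hs => by
    calc ∑ t ∈ K, (p ^ (s ∪ t).card - p ^ 3 * p ^ 3)
        ≤ ∑ t ∈ K, ((if s = t then p ^ 3 else 0) + p ^ 4 * ((s ∩ t).card : ℝ)) :=
          Finset.sum_le_sum fun t ht => pow_card_union_sub_le hp0 hp1 (hcard s hs) (hcard t ht)
      _ = p ^ 3 + p ^ 4 * ∑ v ∈ s, ((K.filter (fun t => v ∈ t)).card : ℝ) := by
          rw [Finset.sum_add_distrib, Finset.sum_ite_eq, if_pos hs, ← Finset.mul_sum]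
          congr 2
          exact_mod_cast sum_card_inter_eq_sum_card_filter K s
      _ ≤ p ^ 3 + p ^ 4 * (3 * τ) := by
          gcongr
          calc ∑ v ∈ s, ((K.filter (fun t => v ∈ t)).card : ℝ)
              ≤ ∑ _v ∈ s, τ := Finset.sum_le_sum fun v _ => hlight v
            _ = 3 * τ := by
              rw [Finset.sum_const, hcard s hs, nsmul_eq_mul, Nat.cast_ofNat]
  calc ∑ s ∈ K, ∑ t ∈ K, p ^ (s ∪ t).card - (∑ s ∈ K, p ^ s.card) ^ 2
      = ∑ s ∈ K, ∑ t ∈ K, (p ^ (s ∪ t).card - p ^ 3 * p ^ 3) := by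
        have hmean : ∑ s ∈ K, p ^ s.card = ∑ _s ∈ K, p ^ 3 :=
          Finset.sum_congr rfl fun s hs => by rw [hcard s hs]
        simp_rw [hmean, Finset.sum_sub_distrib]
        rw [sq, Finset.sum_mul_sum]
    _ ≤ ∑ _s ∈ K, (p ^ 3 + p ^ 4 * (3 * τ)) := Finset.sum_le_sum hrow
    _ = p ^ 3 * (K.card : ℝ) + 3 * p ^ 4 * τ * (K.card : ℝ) := by
        rw [Finset.sum_const, nsmul_eq_mul]
        ring
end

section
/- Let G be a finite simple graph, let τ ≥ 1 be a real number, and let v be a vertex of G contained in at least τ triangles of G. Perform k = ⌈6τ²⌉ independent rounds, where in each round every vertex of G is kept independently with probability p = 1/τ, and let X be the total number over all rounds of triangles containing v whose three vertices are all kept in that round. Then E[X] ≥ 6·T_v/τ and P(X = 0) ≤ 1/3. -/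
open Finset

/-- The probability that every vertex of `S` is kept is `p ^ #S`. -/
theorem sum_bernoulli_mul_indicator {V : Type*} [Fintype V] [DecidableEq V] (p : ℝ)
    (S : Finset V) :
    ∑ f : V → Bool, (∏ u, if f u then p else 1 - p) * (if ∀ u ∈ S, f u = true then 1 else 0)
      = p ^ #S := by
  have hprod (f : V → Bool) :
      (∏ u, if f u then p else 1 - p) * (if ∀ u ∈ S, f u = true then (1 : ℝ) else 0)
        = ∏ u, (if f u then p else 1 - p) * (if u ∈ S → f u = true then (1 : ℝ) else 0) := by
    rw [Finset.prod_mul_distrib, Fintype.prod_boole]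
  simp_rw [hprod]
  rw [← Fintype.prod_sum
    (f := fun u (b : Bool) => (if b then p else 1 - p) * (if u ∈ S → b = true then (1 : ℝ) else 0))]
  have hfactor (u : V) :
      ∑ b : Bool, (if b then p else 1 - p) * (if u ∈ S → b = true then (1 : ℝ) else 0)
        = if u ∈ S then p else 1 := by
    by_cases hu : u ∈ S <;> simp [hu]
  simp_rw [hfactor]
  simp

theorem sum_bernoulli_weight {V : Type*} [Fintype V] [DecidableEq V] (p : ℝ) :
    ∑ f : V → Bool, (∏ u, if f u then p else 1 - p) = 1 := by
  simpa using sum_bernoulli_mul_indicator p (∅ : Finset V)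

/-- Linearity of expectation over `k` independent rounds. -/
theorem sum_pi_prod_mul_sum {α : Type*} [Fintype α] (W Y : α → ℝ) (hW : ∑ a, W a = 1) (k : ℕ) :
    ∑ g : Fin k → α, (∏ i, W (g i)) * ∑ i, Y (g i) = k * ∑ a, W a * Y a := by
  classical
  simp_rw [Finset.mul_sum]
  rw [Finset.sum_comm]
  have hround (i : Fin k) :
      ∑ g : Fin k → α, (∏ j, W (g j)) * Y (g i) = ∑ a, W a * Y a := by
    have hprod (g : Fin k → α) : (∏ j, W (g j)) * Y (g i)
        = ∏ j, W (g j) * (if j = i then Y (g j) else 1) := by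
      rw [Finset.prod_mul_distrib]
      simp
    simp_rw [hprod]
    rw [← Fintype.prod_sum (f := fun j a => W a * (if j = i then Y a else 1)),
      Finset.prod_eq_single i]
    · simp
    · intro j _ hj
      simp [hj, hW]
    · simp
  simp_rw [hround]
  simp [Finset.mul_sum]

/-- The probability that an event occurs in each of `k` independent rounds. -/
theorem sum_pi_filter_prod {α : Type*} [Fintype α] (W : α → ℝ) (P : α → Prop)
    [DecidablePred P] (k : ℕ) [DecidablePred fun g : Fin k → α => ∀ i, P (g i)] :
    ∑ g : Fin k → α with ∀ i, P (g i), ∏ i, W (g i) = (∑ a with P a, W a) ^ k := by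
  rw [Finset.sum_filter, Finset.sum_filter, Fintype.sum_pow]
  refine Finset.sum_congr rfl fun g _ => ?_
  by_cases h : ∀ i, P (g i)
  · simp [h]
  · rw [if_neg h]
    obtain ⟨i, hi⟩ := not_forall.mp h
    exact (Finset.prod_eq_zero (mem_univ i) (if_neg hi)).symm

/-- The number of members of `A` all of whose vertices are kept by `f`. -/
def keptCount {V : Type*} [Fintype V] [DecidableEq V] (A : Finset (Finset V)) (f : V → Bool) : ℝ :=
  ∑ S ∈ A, if ∀ u ∈ S, f u = true then 1 else 0

theorem keptCount_nonneg {V : Type*} [Fintype V] [DecidableEq V] (A : Finset (Finset V))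
    (f : V → Bool) : 0 ≤ keptCount A f :=
  Finset.sum_nonneg fun _ _ => by split_ifs <;> norm_num

/-- The expected number of kept triples. -/
theorem sum_bernoulli_mul_keptCount {V : Type*} [Fintype V] [DecidableEq V] (p : ℝ)
    (A : Finset (Finset V)) (hA : ∀ S ∈ A, #S = 3) :
    ∑ f : V → Bool, (∏ u, if f u then p else 1 - p) * keptCount A f = #A * p ^ 3 := by
  simp_rw [keptCount, Finset.mul_sum]
  rw [Finset.sum_comm]
  simp_rw [sum_bernoulli_mul_indicator]
  rw [Finset.sum_congr rfl fun S hS => by rw [hA S hS]]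
  simp

/-- A bound on the second moment of the number of kept triples. -/
theorem sum_bernoulli_mul_keptCount_sq_le {V : Type*} [Fintype V] [DecidableEq V] {p : ℝ}
    (hp0 : 0 ≤ p) (hp1 : p ≤ 1) (A : Finset (Finset V)) (hA : ∀ S ∈ A, #S = 3) :
    ∑ f : V → Bool, (∏ u, if f u then p else 1 - p) * keptCount A f ^ 2
      ≤ #A * p ^ 3 + (#A : ℝ) ^ 2 * p ^ 4 := by
  have hsq (f : V → Bool) : keptCount A f ^ 2
      = ∑ S ∈ A, ∑ T ∈ A, if ∀ u ∈ S ∪ T, f u = true then (1 : ℝ) else 0 := by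
    rw [keptCount, sq, Finset.sum_mul_sum]
    refine Finset.sum_congr rfl fun S _ => Finset.sum_congr rfl fun T _ => ?_
    simp only [Finset.forall_mem_union, ite_and, ite_mul, one_mul, zero_mul]
  have hpair : ∀ S ∈ A, ∀ T ∈ A, p ^ #(S ∪ T) ≤ (if S = T then p ^ 3 else 0) + p ^ 4 := by
    intro S hS T hT
    split_ifs with h
    · subst h
      rw [union_self, hA S hS]
      linarith [pow_nonneg hp0 4]
    · rw [zero_add]
      refine pow_le_pow_of_le_one hp0 hp1 ?_
      by_contra! hlt
      have hST : S = S ∪ T := Finset.eq_of_subset_of_card_le subset_union_left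
        (by rw [hA S hS]; omega)
      have hTS : T = S ∪ T := Finset.eq_of_subset_of_card_le subset_union_right
        (by rw [hA T hT]; omega)
      exact h (hST.trans hTS.symm)
  calc ∑ f : V → Bool, (∏ u, if f u then p else 1 - p) * keptCount A f ^ 2
      = ∑ S ∈ A, ∑ T ∈ A, p ^ #(S ∪ T) := by
        simp_rw [hsq, Finset.mul_sum]
        rw [Finset.sum_comm]
        refine Finset.sum_congr rfl fun S _ => ?_
        rw [Finset.sum_comm]
        exact Finset.sum_congr rfl fun T _ => sum_bernoulli_mul_indicator p (S ∪ T)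
    _ ≤ ∑ S ∈ A, ∑ T ∈ A, ((if S = T then p ^ 3 else 0) + p ^ 4) :=
        Finset.sum_le_sum fun S hS => Finset.sum_le_sum fun T hT => hpair S hS T hT
    _ = #A * p ^ 3 + (#A : ℝ) ^ 2 * p ^ 4 := by
        simp [Finset.sum_add_distrib]
        ring

/-- The second moment method: the probability that no triple is kept. -/
theorem sum_bernoulli_keptCount_eq_zero_le {V : Type*} [Fintype V] [DecidableEq V] {p : ℝ}
    (hp0 : 0 ≤ p) (hp1 : p ≤ 1) (A : Finset (Finset V)) (hA : ∀ S ∈ A, #S = 3)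
    (hAp : 1 ≤ #A * p) [DecidablePred fun f : V → Bool => keptCount A f = 0] :
    ∑ f : V → Bool with keptCount A f = 0, (∏ u, if f u then p else 1 - p)
      ≤ 1 - p ^ 2 / 2 := by
  set c : ℝ := 1 / (1 + #A * p) with hc
  have hw (f : V → Bool) : 0 ≤ ∏ u, if f u then p else 1 - p :=
    Finset.prod_nonneg fun u _ => by split_ifs <;> linarith
  have hpoint (f : V → Bool) :
      (if keptCount A f = 0 then ∏ u, (if f u then p else 1 - p) else 0)
        ≤ (∏ u, if f u then p else 1 - p)
          - 2 * c * ((∏ u, if f u then p else 1 - p) * keptCount A f)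
          + c ^ 2 * ((∏ u, if f u then p else 1 - p) * keptCount A f ^ 2) := by
    split_ifs with h
    · simp [h]
    · nlinarith [mul_nonneg (hw f) (sq_nonneg (1 - c * keptCount A f))]
  have hsecond := mul_le_mul_of_nonneg_left
    (sum_bernoulli_mul_keptCount_sq_le hp0 hp1 A hA) (sq_nonneg c)
  have hden : 0 < 1 + #A * p := by linarith
  calc ∑ f : V → Bool with keptCount A f = 0, (∏ u, if f u then p else 1 - p)
      ≤ 1 - 2 * c * (#A * p ^ 3) + c ^ 2 * (#A * p ^ 3 + (#A : ℝ) ^ 2 * p ^ 4) := by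
        rw [Finset.sum_filter]
        refine (Finset.sum_le_sum fun f _ => hpoint f).trans ?_
        rw [Finset.sum_add_distrib, Finset.sum_sub_distrib, ← Finset.mul_sum, ← Finset.mul_sum,
          sum_bernoulli_weight, sum_bernoulli_mul_keptCount p A hA]
        linarith
    _ = 1 - p ^ 2 * (#A * p / (1 + #A * p)) := by
        rw [hc]
        field_simp
        ring
    _ ≤ 1 - p ^ 2 / 2 := by
        have hhalf : 1 / 2 ≤ #A * p / (1 + #A * p) := by
          rw [div_le_div_iff₀ two_pos hden]
          linarith
        nlinarith [mul_le_mul_of_nonneg_left hhalf (sq_nonneg p)]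

open scoped Classical in
/-- Let `v` be a vertex of a finite simple graph `G` contained in
`T_v ≥ τ` triangles (`τ ≥ 1`). Perform `k = ⌈6τ²⌉` independent rounds, each keeping
every vertex independently with probability `1/τ`, and let `X` be the total number, over
all rounds, of triangles containing `v` fully kept in that round. Then
`E[X] ≥ 6·T_v/τ` and `P(X = 0) ≤ 1/3`. -/
theorem heavy_vertex_detected
    {V : Type*} [Fintype V] [DecidableEq V]
    (G : SimpleGraph V) [DecidableRel G.Adj] (v : V) (τ : ℝ) (hτ : 1 ≤ τ)
    (Tv : ℝ) (hTv : Tv = (((G.cliqueFinset 3).filter (fun Δ => v ∈ Δ)).card : ℝ))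
    (hheavy : τ ≤ Tv)
    (k : ℕ) (hk : k = ⌈6 * τ ^ 2⌉₊)
    (X : (Fin k → V → Bool) → ℝ)
    (hX : ∀ g, X g = ∑ i : Fin k,
      (((G.cliqueFinset 3).filter (fun Δ => v ∈ Δ ∧ ∀ u ∈ Δ, g i u = true)).card : ℝ)) :
    6 * Tv / τ ≤
      (∑ g : Fin k → V → Bool,
        (∏ i : Fin k, ∏ u : V, if g i u then 1 / τ else 1 - 1 / τ) * X g) ∧
    (∑ g ∈ (Finset.univ : Finset (Fin k → V → Bool)).filter (fun g => X g = 0),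
        ∏ i : Fin k, ∏ u : V, if g i u then 1 / τ else 1 - 1 / τ)
      ≤ 1 / 3 := by
  set A := (G.cliqueFinset 3).filter (fun Δ => v ∈ Δ) with hAdef
  have hτ0 : 0 < τ := by linarith
  have hA : ∀ S ∈ A, #S = 3 := fun S hS =>
    (SimpleGraph.mem_cliqueFinset_iff.mp (Finset.mem_filter.mp hS).1).card_eq
  have hp0 : 0 ≤ 1 / τ := by positivity
  have hp1 : 1 / τ ≤ 1 := by rwa [div_le_one hτ0]
  have hkτ : 6 * τ ^ 2 ≤ k := hk ▸ Nat.le_ceil _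
  have hXY (g : Fin k → V → Bool) : X g = ∑ i, keptCount A (g i) := by
    rw [hX]
    refine Finset.sum_congr rfl fun i _ => ?_
    rw [keptCount, hAdef, Finset.card_filter, Finset.sum_filter]
    push_cast
    refine Finset.sum_congr rfl fun S _ => ?_
    by_cases hv : v ∈ S <;> simp [hv]
  have hXzero (g : Fin k → V → Bool) : X g = 0 ↔ ∀ i, keptCount A (g i) = 0 := by
    rw [hXY, Finset.sum_eq_zero_iff_of_nonneg fun i _ => keptCount_nonneg A (g i)]
    simp
  constructor
  · simp_rw [hXY]
    rw [sum_pi_prod_mul_sum (fun f : V → Bool => ∏ u, if f u then 1 / τ else 1 - 1 / τ)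
      (keptCount A) (sum_bernoulli_weight _), sum_bernoulli_mul_keptCount _ A hA, ← hTv]
    calc 6 * Tv / τ = 6 * τ ^ 2 * (Tv * (1 / τ) ^ 3) := by field_simp
      _ ≤ k * (Tv * (1 / τ) ^ 3) := by
        have : 0 ≤ Tv := by linarith
        gcongr
  · simp_rw [hXzero]
    rw [sum_pi_filter_prod (fun f : V → Bool => ∏ u, if f u then 1 / τ else 1 - 1 / τ)
      (fun f => keptCount A f = 0)]
    have hAp : 1 ≤ #A * (1 / τ) := by
      rw [← hTv, mul_one_div, one_le_div hτ0]
      exact hheavy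
    have hround := sum_bernoulli_keptCount_eq_zero_le hp0 hp1 A hA hAp
    calc _ ≤ (1 - (1 / τ) ^ 2 / 2) ^ k := by
          refine pow_le_pow_left₀ (Finset.sum_nonneg fun f _ =>
            Finset.prod_nonneg fun u _ => ?_) hround k
          split_ifs <;> linarith
      _ ≤ Real.exp (-((1 / τ) ^ 2 / 2)) ^ k := by
          refine pow_le_pow_left₀ ?_ (Real.one_sub_le_exp_neg _) k
          nlinarith
      _ = Real.exp (-(k * ((1 / τ) ^ 2 / 2))) := by
          rw [← Real.exp_nat_mul, mul_neg]
      _ ≤ Real.exp (-3) := by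
          refine Real.exp_le_exp.mpr (neg_le_neg ?_)
          calc (3 : ℝ) = 6 * τ ^ 2 * ((1 / τ) ^ 2 / 2) := by
                field_simp
                norm_num
            _ ≤ k * ((1 / τ) ^ 2 / 2) := by gcongr
      _ ≤ 1 / 3 := by
          rw [Real.exp_neg, ← one_div]
          exact one_div_le_one_div_of_le three_pos (by linarith [Real.add_one_le_exp (3 : ℝ)])
end

section
/- Let G be a finite simple graph with m ≥ 1 edges, let ≺ be a linear order on its vertex set such that u ≺ v implies d(u) ≤ d(v), let V_H be a subset of the vertex set, and suppose every vertex not in V_H has degree at most θ. Consider the random experiment: choose an edge e = {a, b} uniformly at random with a ≺ b, then choose a vertex w uniformly at random among the neighbors of a, and set X = d(a) if a ∉ V_H, a ≺ w, and {a, b, w} is a triangle of G, and X = 0 otherwise. Then E[(m/2)·X] = T_L, where T_L is the number of triangles of G whose ≺-minimal vertex does not belong to V_H, and moreover Var((m/2)·X) ≤ (θ·m/2)·T_L. -/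
open Finset

/-- The triples `(a, b, w)` spanning a triangle of `G` whose smallest vertex `a` is not
in `VH`. -/
def lightTriples {V : Type*} [Fintype V] [DecidableEq V] [LinearOrder V]
    (G : SimpleGraph V) [DecidableRel G.Adj] (VH : Finset V) : Finset ((V × V) × V) :=
  Finset.univ.filter fun t => t.1.1 ∉ VH ∧ t.1.1 < t.1.2 ∧ t.1.1 < t.2 ∧
    G.Adj t.1.1 t.1.2 ∧ G.Adj t.1.1 t.2 ∧ G.Adj t.1.2 t.2

/-- Every triangle whose smallest vertex is not in `VH` comes from exactly two triples. -/
theorem card_lightTriples {V : Type*} [Fintype V] [DecidableEq V] [LinearOrder V]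
    (G : SimpleGraph V) [DecidableRel G.Adj] (VH : Finset V) :
    (lightTriples G VH).card = 2 * ((G.cliqueFinset 3).filter
      (fun Δ => ∃ a ∈ Δ, a ∉ VH ∧ ∀ b ∈ Δ, a ≤ b)).card := by
  have hmaps : ∀ t ∈ lightTriples G VH, ({t.1.1, t.1.2, t.2} : Finset V) ∈
      (G.cliqueFinset 3).filter (fun Δ => ∃ a ∈ Δ, a ∉ VH ∧ ∀ b ∈ Δ, a ≤ b) := by
    rintro ⟨⟨a, b⟩, w⟩ ht
    simp only [lightTriples, Finset.mem_filter, Finset.mem_univ, true_and] at ht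
    obtain ⟨h1, h2, h3, h4, h5, h6⟩ := ht
    rw [Finset.mem_filter, SimpleGraph.mem_cliqueFinset_iff, SimpleGraph.is3Clique_triple_iff]
    refine ⟨⟨h4, h5, h6⟩, a, by simp, h1, ?_⟩
    simp [h2.le, h3.le]
  rw [Finset.card_eq_sum_card_fiberwise hmaps, mul_comm, ← smul_eq_mul]
  refine Finset.sum_const_nat (m := 2) ?_
  intro Δ hΔ
  rw [Finset.mem_filter, SimpleGraph.mem_cliqueFinset_iff] at hΔ
  obtain ⟨hΔ, a, ha, haH, hmin⟩ := hΔ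
  obtain ⟨b, c, hbc, herase⟩ := Finset.card_eq_two.mp
    (show (Δ.erase a).card = 2 by rw [Finset.card_erase_of_mem ha, hΔ.card_eq])
  have hmem : ∀ x, x ∈ Δ ↔ x = a ∨ x = b ∨ x = c := by
    intro x
    rw [← Finset.insert_erase ha, herase]
    simp
  have hb : b ∈ Δ.erase a := by simp [herase]
  have hc : c ∈ Δ.erase a := by simp [herase]
  rw [Finset.mem_erase] at hb hc
  have hab : a < b := lt_of_le_of_ne (hmin b hb.2) (Ne.symm hb.1)
  have hac : a < c := lt_of_le_of_ne (hmin c hc.2) (Ne.symm hc.1)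
  have adj_ab : G.Adj a b := hΔ.isClique ha hb.2 hab.ne
  have adj_ac : G.Adj a c := hΔ.isClique ha hc.2 hac.ne
  have adj_bc : G.Adj b c := hΔ.isClique hb.2 hc.2 hbc
  have hfiber : (lightTriples G VH).filter (fun t => ({t.1.1, t.1.2, t.2} : Finset V) = Δ) =
      {((a, b), c), ((a, c), b)} := by
    ext ⟨⟨x, y⟩, z⟩
    simp only [lightTriples, Finset.mem_filter, Finset.mem_univ, true_and, Finset.mem_insert,
      Finset.mem_singleton, Prod.mk.injEq]
    constructor
    · rintro ⟨⟨-, hxy, hxz, -, -, hyz⟩, rfl⟩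
      have hne := hyz.ne
      have hx := (hmem x).1 (by simp)
      have hy := (hmem y).1 (by simp)
      have hz := (hmem z).1 (by simp)
      have hxa : x = a := by
        have := hmin x (by simp)
        have ha' : a = x ∨ a = y ∨ a = z := by simpa using ha
        rcases ha' with h | h | h
        · exact h.symm
        · exact absurd (h ▸ this) hxy.not_ge
        · exact absurd (h ▸ this) hxz.not_ge
      subst hxa
      grind
    · rintro (⟨⟨rfl, rfl⟩, rfl⟩ | ⟨⟨rfl, rfl⟩, rfl⟩)
      · refine ⟨⟨haH, hab, hac, adj_ab, adj_ac, adj_bc⟩, ?_⟩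
        ext x
        simp [hmem]
      · refine ⟨⟨haH, hac, hab, adj_ac, adj_ab, adj_bc.symm⟩, ?_⟩
        ext x
        simp only [hmem, Finset.mem_insert, Finset.mem_singleton]
        tauto
  rw [hfiber, Finset.card_pair]
  simp [hbc]

/-- A sum over an ordered edge and a neighbor of its smaller endpoint reduces to
the light triples when the summand vanishes on all other outcomes. -/
theorem sum_edges_neighbors_eq_sum_lightTriples
    {V : Type*} [Fintype V] [DecidableEq V] [LinearOrder V]
    (G : SimpleGraph V) [DecidableRel G.Adj] (VH : Finset V) (f : V × V → V → ℝ)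
    (hf : ∀ q w, ¬ (q.1 ∉ VH ∧ q.1 < w ∧ ({q.1, q.2, w} : Finset V) ∈ G.cliqueFinset 3) →
      f q w = 0) :
    ∑ q ∈ (Finset.univ : Finset (V × V)).filter (fun q => q.1 < q.2 ∧ G.Adj q.1 q.2),
      ∑ w ∈ G.neighborFinset q.1, f q w = ∑ t ∈ lightTriples G VH, f t.1 t.2 := by
  rw [Finset.sum_sigma']
  symm
  refine Finset.sum_of_injOn (fun t => ⟨t.1, t.2⟩) ?_ ?_ ?_ ?_
  · rintro ⟨q, w⟩ - ⟨q', w'⟩ - h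
    simpa using h
  · rintro ⟨⟨a, b⟩, w⟩ ht
    simp only [lightTriples, Finset.coe_filter, Finset.mem_univ, true_and,
      Set.mem_ofPred_eq] at ht
    simp [ht]
  · rintro ⟨⟨a, b⟩, w⟩ h hnot
    apply hf
    rintro ⟨haH, haw, htri⟩
    rw [SimpleGraph.mem_cliqueFinset_iff, SimpleGraph.is3Clique_triple_iff] at htri
    simp only [Finset.mem_sigma, Finset.mem_filter, Finset.mem_univ, true_and] at h
    exact hnot ⟨((a, b), w), by simp_all [lightTriples], rfl⟩
  · intro t _
    rfl

/-- Let `G` have `m ≥ 1` edges, `≺` a linear order on the vertices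
refining the degree order, `V_H` a set of vertices such that every vertex outside `V_H`
has degree at most `θ`. Draw an edge `e = {a, b}` (with `a ≺ b`) uniformly at random,
then a uniform random neighbor `w` of `a`, and set `X = d(a)` if `a ∉ V_H`, `a ≺ w` and
`{a, b, w}` is a triangle, and `X = 0` otherwise. Then `E[(m/2)·X] = T_L` and
`Var((m/2)·X) ≤ (θ·m/2)·T_L`, where `T_L` is the number of triangles whose `≺`-minimal
vertex is not in `V_H`. Edges are encoded as ordered pairs `(a, b)` with `a < b`;
the distribution gives weight `1/(m·d(a))` to each outcome `(e, w)`. -/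
theorem light_triangle_estimator_mean_and_variance
    {V : Type*} [Fintype V] [DecidableEq V] [LinearOrder V]
    (G : SimpleGraph V) [DecidableRel G.Adj]
    (hmono : ∀ u w : V, u < w → G.degree u ≤ G.degree w)
    (m : ℕ) (hm : m = G.edgeFinset.card) (hm1 : 1 ≤ m)
    (VH : Finset V) (θ : ℝ) (hθ : ∀ u : V, u ∉ VH → (G.degree u : ℝ) ≤ θ)
    (TL : ℕ) (hTL : TL = ((G.cliqueFinset 3).filter
      (fun Δ => ∃ a ∈ Δ, a ∉ VH ∧ ∀ b ∈ Δ, a ≤ b)).card)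
    (X : V × V → V → ℝ)
    (hX : ∀ q w, X q w =
      if q.1 ∉ VH ∧ q.1 < w ∧ ({q.1, q.2, w} : Finset V) ∈ G.cliqueFinset 3
        then (G.degree q.1 : ℝ) else 0)
    (EX : ℝ)
    (hEX : EX = ∑ q ∈ (Finset.univ : Finset (V × V)).filter
        (fun q => q.1 < q.2 ∧ G.Adj q.1 q.2),
      ∑ w ∈ G.neighborFinset q.1,
        (1 / ((m : ℝ) * (G.degree q.1 : ℝ))) * ((m : ℝ) / 2 * X q w)) :
    EX = (TL : ℝ) ∧
    (∑ q ∈ (Finset.univ : Finset (V × V)).filter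
        (fun q => q.1 < q.2 ∧ G.Adj q.1 q.2),
      ∑ w ∈ G.neighborFinset q.1,
        (1 / ((m : ℝ) * (G.degree q.1 : ℝ))) * ((m : ℝ) / 2 * X q w) ^ 2)
      - EX ^ 2
      ≤ θ * (m : ℝ) / 2 * (TL : ℝ) := by
  have hm0 : (0 : ℝ) < m := by exact_mod_cast hm1
  have hcard : ((lightTriples G VH).card : ℝ) = 2 * TL := by
    rw [card_lightTriples, hTL]
    push_cast
    rfl
  have hXt : ∀ t ∈ lightTriples G VH, X t.1 t.2 = G.degree t.1.1 ∧
      (0 : ℝ) < G.degree t.1.1 ∧ (G.degree t.1.1 : ℝ) ≤ θ := by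
    intro t ht
    simp only [lightTriples, Finset.mem_filter, Finset.mem_univ, true_and] at ht
    obtain ⟨haH, -, haw, hab, haw', hbw⟩ := ht
    refine ⟨?_, ?_, hθ _ haH⟩
    · rw [hX, if_pos]
      refine ⟨haH, haw, ?_⟩
      rw [SimpleGraph.mem_cliqueFinset_iff, SimpleGraph.is3Clique_triple_iff]
      exact ⟨hab, haw', hbw⟩
    · exact_mod_cast (G.degree_pos_iff_exists_adj _).2 ⟨_, hab⟩
  have hmean : EX = TL := by
    rw [hEX, sum_edges_neighbors_eq_sum_lightTriples G VH
      (fun q w => (1 / ((m : ℝ) * (G.degree q.1 : ℝ))) * ((m : ℝ) / 2 * X q w))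
      (fun q w h => by simp only [hX, if_neg h, mul_zero])]
    rw [Finset.sum_congr rfl (g := fun _ => (1 / 2 : ℝ)), Finset.sum_const, nsmul_eq_mul, hcard]
    · ring
    · intro t ht
      obtain ⟨h1, h2, -⟩ := hXt t ht
      simp only [h1]
      field_simp
  refine ⟨hmean, ?_⟩
  rw [sum_edges_neighbors_eq_sum_lightTriples G VH
    (fun q w => (1 / ((m : ℝ) * (G.degree q.1 : ℝ))) * ((m : ℝ) / 2 * X q w) ^ 2)
    (fun q w h => by rw [hX, if_neg h]; ring)]
  have hsecond : ∑ t ∈ lightTriples G VH,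
      (1 / ((m : ℝ) * (G.degree t.1.1 : ℝ))) * ((m : ℝ) / 2 * X t.1 t.2) ^ 2 ≤
      (lightTriples G VH).card • (θ * m / 4) := by
    refine Finset.sum_le_card_nsmul _ _ _ fun t ht => ?_
    obtain ⟨h1, h2, h3⟩ := hXt t ht
    rw [h1]
    calc (1 / ((m : ℝ) * (G.degree t.1.1 : ℝ))) * ((m : ℝ) / 2 * G.degree t.1.1) ^ 2
        = G.degree t.1.1 * m / 4 := by field_simp; norm_num
      _ ≤ θ * m / 4 := by gcongr
  rw [nsmul_eq_mul, hcard] at hsecond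
  nlinarith [sq_nonneg EX]
end
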